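/- For every y > 0, y³ · (θ₂(iy) θ₃(iy) θ₄(iy))⁴ ≤ (θ₂(i) θ₃(i) θ₄(i))⁴, with equality if and only if y = 1. (Equivalently, the zeta-regularized determinant of the Laplace–Beltrami operator on the rectangular torus ℂ/(y^{1/2}ℤ × i y^{−1/2}ℤ), which equals y·η(iy)⁴ in terms of the Dedekind eta function, is maximal exactly at the square torus y = 1.) -/

import Mathlib

noncomputable section

/-- The Jacobi theta-null `θ₂(iy) = Σ_{k∈ℤ} e^{-π (k+1/2)² y}` for `y > 0`. -/
def theta2 (y : ℝ) : ℝ := ∑' k : ℤ, Real.exp (-Real.pi * ((k : ℝ) + 1 / 2) ^ 2 * y)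

/-- The Jacobi theta-null `θ₃(iy) = Σ_{k∈ℤ} e^{-π k² y}` for `y > 0`. -/
def theta3 (y : ℝ) : ℝ := ∑' k : ℤ, Real.exp (-Real.pi * (k : ℝ) ^ 2 * y)

/-- The Jacobi theta-null `θ₄(iy) = Σ_{k∈ℤ} (-1)^k e^{-π k² y}` for `y > 0`. -/
def theta4 (y : ℝ) : ℝ := ∑' k : ℤ, (-1 : ℝ) ^ k * Real.exp (-Real.pi * (k : ℝ) ^ 2 * y)

theorem convexOn_exp_neg_exp_combination {A B D N : ℝ}
    (h : ∀ s : ℝ, 3 ≤ s → 0 ≤ A * ((s ^ 2 - s) * Real.exp (-s)) +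
      B * (((N * s) ^ 2 - N * s) * Real.exp (-(N * s))) + D * s) :
    ConvexOn ℝ (Set.Ici (Real.log 3)) (fun t => A * Real.exp (-Real.exp t) +
      B * Real.exp (-(N * Real.exp t)) + D * Real.exp t) := by
  have hE (M t : ℝ) : HasDerivAt (fun t => Real.exp (-(M * Real.exp t)))
      (-(M * Real.exp t) * Real.exp (-(M * Real.exp t))) t := by
    simpa [mul_comm] using (((Real.hasDerivAt_exp t).const_mul M).neg).exp
  have hE2 (M t : ℝ) :
      HasDerivAt (fun t => -(M * Real.exp t) * Real.exp (-(M * Real.exp t)))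
      (((M * Real.exp t) ^ 2 - M * Real.exp t) * Real.exp (-(M * Real.exp t))) t := by
    exact ((((Real.hasDerivAt_exp t).const_mul M).fun_neg).fun_mul (hE M t)).congr_deriv (by ring)
  have h1 (t : ℝ) := hE 1 t
  have h2 (t : ℝ) := hE2 1 t
  simp only [one_mul] at h1 h2
  refine convexOn_of_hasDerivWithinAt2_nonneg (convex_Ici _) (by fun_prop)
    (fun t _ => ((((h1 t).const_mul A).add ((hE N t).const_mul B)).add
      ((Real.hasDerivAt_exp t).const_mul D)).hasDerivWithinAt)
    (fun t _ => ((((h2 t).const_mul A).add ((hE2 N t).const_mul B)).add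
      ((Real.hasDerivAt_exp t).const_mul D)).hasDerivWithinAt) ?_
  intro t ht
  rw [interior_Ici] at ht
  refine h _ ?_
  rw [← Real.log_le_iff_le_exp (by norm_num)]
  exact le_of_lt ht

/-- Second difference of `f` at the points `a`, `c`, `b`. -/
def midDiff (a b c : ℝ) (f : ℝ → ℝ) : ℝ := f a + f b - 2 * f c

theorem midDiff_exp_combination_nonneg {A B D N a b c : ℝ} (ha : 3 ≤ a) (hb : 3 ≤ b) (hc : 0 < c)
    (habc : a * b = c ^ 2)
    (h : ∀ s : ℝ, 3 ≤ s → 0 ≤ A * ((s ^ 2 - s) * Real.exp (-s)) +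
      B * (((N * s) ^ 2 - N * s) * Real.exp (-(N * s))) + D * s) :
    0 ≤ A * midDiff a b c (fun s => Real.exp (-s)) +
      B * midDiff a b c (fun s => Real.exp (-(N * s))) + D * midDiff a b c (fun s => s) := by
  have ha0 : 0 < a := by linarith
  have hb0 : 0 < b := by linarith
  have hl : Real.log c = (1 / 2 : ℝ) • Real.log a + (1 / 2 : ℝ) • Real.log b := by
    have := congrArg Real.log habc
    rw [Real.log_mul ha0.ne' hb0.ne', Real.log_pow] at this
    simp only [smul_eq_mul]
    push_cast at this
    linarith
  have := (convexOn_exp_neg_exp_combination h).2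
    (Real.log_le_log (by norm_num) ha : Real.log a ∈ Set.Ici (Real.log 3))
    (Real.log_le_log (by norm_num) hb : Real.log b ∈ Set.Ici (Real.log 3))
    (by norm_num : (0 : ℝ) ≤ 1 / 2) (by norm_num : (0 : ℝ) ≤ 1 / 2) (by norm_num)
  rw [← hl] at this
  simp only [Real.exp_log ha0, Real.exp_log hb0, Real.exp_log hc, smul_eq_mul] at this
  simp only [midDiff]
  linarith

theorem exp_neg_three_lt : Real.exp (-3) < 1 / 20 := by
  have h : Real.exp (-3) = Real.exp (-1) ^ 3 := by
    rw [← Real.exp_nat_mul]; norm_num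
  rw [h]
  have h1 := Real.exp_neg_one_lt_d9
  calc Real.exp (-1) ^ 3 ≤ (0.3678794412 : ℝ) ^ 3 := by gcongr
    _ < 1 / 20 := by norm_num

theorem midDiff_exp_neg_le {a b c : ℝ} (ha : 3 ≤ a) (hb : 3 ≤ b) (hc : 0 < c)
    (habc : a * b = c ^ 2) :
    midDiff a b c (fun s => Real.exp (-s)) ≤ 1 / 10 * midDiff a b c (fun s => s) := by
  have := midDiff_exp_combination_nonneg (A := -1) (B := 0) (D := 1 / 10) (N := 0) ha hb hc habc ?_
  · linarith
  intro s hs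
  have h : (s - 1) * Real.exp (-s) ≤ 1 / 10 := by
    have h1 : s - 1 ≤ 2 * Real.exp (s - 3) := by
      have := Real.add_one_le_exp (s - 3)
      linarith
    calc (s - 1) * Real.exp (-s) ≤ 2 * Real.exp (s - 3) * Real.exp (-s) := by gcongr
      _ = 2 * Real.exp (-3) := by rw [mul_assoc, ← Real.exp_add]; ring_nf
      _ ≤ 1 / 10 := by linarith [exp_neg_three_lt]
  nlinarith

theorem sq_mul_exp_neg_le (m : ℕ) {s : ℝ} (hs : 3 ≤ s) :
    3 / 2 * ((m : ℝ) + 2) ^ 2 * Real.exp (-((m + 1) * s)) ≤ 1 / 3 * (1 / 8) ^ m := by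
  induction m with
  | zero =>
    have : Real.exp (-s) ≤ Real.exp (-3) := by gcongr
    norm_num
    linarith [exp_neg_three_lt]
  | succ m ih =>
    have h3 : Real.exp (-s) ≤ 1 / 20 := by
      have : Real.exp (-s) ≤ Real.exp (-3) := by gcongr
      linarith [exp_neg_three_lt]
    have he : Real.exp (-(((m + 1 : ℕ) + 1) * s)) = Real.exp (-((m + 1) * s)) * Real.exp (-s) := by
      rw [← Real.exp_add]; push_cast; ring_nf
    rw [he, pow_succ]
    push_cast
    have hm : ((m : ℝ) + 1 + 2) ^ 2 ≤ 9 / 4 * (m + 2) ^ 2 := by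
      have : (0 : ℝ) ≤ m := m.cast_nonneg
      nlinarith
    calc 3 / 2 * ((m : ℝ) + 1 + 2) ^ 2 * (Real.exp (-((m + 1) * s)) * Real.exp (-s))
        ≤ 3 / 2 * (9 / 4 * ((m : ℝ) + 2) ^ 2) * (Real.exp (-((m + 1) * s)) * (1 / 20)) := by gcongr
      _ = 9 / 80 * (3 / 2 * ((m : ℝ) + 2) ^ 2 * Real.exp (-((m + 1) * s))) := by ring
      _ ≤ 1 / 8 * (3 / 2 * ((m : ℝ) + 2) ^ 2 * Real.exp (-((m + 1) * s))) := by
        exact mul_le_mul_of_nonneg_right (by norm_num) (by positivity)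
      _ ≤ 1 / 8 * (1 / 3 * (1 / 8) ^ m) := by gcongr
      _ = _ := by ring

theorem abs_midDiff_exp_neg_mul_le (m : ℕ) {a b c : ℝ} (ha : 3 ≤ a) (hb : 3 ≤ b) (hc : 0 < c)
    (habc : a * b = c ^ 2) :
    |midDiff a b c (fun s => Real.exp (-(((m : ℝ) + 2) * s)))| ≤
      1 / 3 * (1 / 8) ^ m * midDiff a b c (fun s => Real.exp (-s)) := by
  have key (s : ℝ) (hs : 3 ≤ s) : |(((m : ℝ) + 2) * s) ^ 2 - (m + 2) * s| *
      Real.exp (-((m + 2) * s)) ≤ 1 / 3 * (1 / 8) ^ m * ((s ^ 2 - s) * Real.exp (-s)) := by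
    have hm : (0 : ℝ) ≤ m := m.cast_nonneg
    have h1 : |(((m : ℝ) + 2) * s) ^ 2 - (m + 2) * s| ≤ ((m + 2) * s) ^ 2 := by
      have : 1 ≤ ((m : ℝ) + 2) * s := by nlinarith
      rw [abs_le]
      constructor <;> nlinarith
    have he : Real.exp (-((m + 2) * s)) = Real.exp (-((m + 1) * s)) * Real.exp (-s) := by
      rw [← Real.exp_add]; ring_nf
    calc _ ≤ ((m + 2) * s) ^ 2 * Real.exp (-((m + 2) * s)) := by gcongr
      _ = (3 / 2 * ((m : ℝ) + 2) ^ 2 * Real.exp (-((m + 1) * s))) *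
          ((2 / 3 * s ^ 2) * Real.exp (-s)) := by rw [he]; ring
      _ ≤ (1 / 3 * (1 / 8) ^ m) * ((s ^ 2 - s) * Real.exp (-s)) := by
        gcongr ?_ * (?_ * _)
        · exact sq_mul_exp_neg_le m hs
        · nlinarith
  rw [abs_le]
  constructor
  · have := midDiff_exp_combination_nonneg (A := 1 / 3 * (1 / 8) ^ m) (B := 1) (D := 0)
      (N := m + 2) ha hb hc habc ?_
    · linarith
    intro s hs
    have h1 := key s hs
    have h2 := mul_le_mul_of_nonneg_right (neg_abs_le ((((m : ℝ) + 2) * s) ^ 2 - (m + 2) * s))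
      (Real.exp_nonneg (-((m + 2) * s)))
    linarith
  · have := midDiff_exp_combination_nonneg (A := 1 / 3 * (1 / 8) ^ m) (B := -1) (D := 0)
      (N := m + 2) ha hb hc habc ?_
    · linarith
    intro s hs
    have h1 := key s hs
    have h2 := mul_le_mul_of_nonneg_right (le_abs_self ((((m : ℝ) + 2) * s) ^ 2 - (m + 2) * s))
      (Real.exp_nonneg (-((m + 2) * s)))
    linarith

theorem summable_mul_exp_neg {u : ℕ → ℝ} (hu : ∀ n, |u n| ≤ 1) {m : ℕ → ℕ} (hm : ∀ n, n ≤ m n)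
    {s : ℝ} (hs : 0 < s) : Summable (fun n => u n * Real.exp (-(((m n : ℝ) + 2) * s))) := by
  refine Summable.of_norm_bounded (g := fun n : ℕ => Real.exp (-s) ^ n)
    (summable_geometric_of_lt_one (Real.exp_nonneg _) (by simpa using hs)) fun n => ?_
  rw [Real.norm_eq_abs, abs_mul, Real.abs_exp, ← Real.exp_nat_mul]
  have h1 : Real.exp (-(((m n : ℝ) + 2) * s)) ≤ Real.exp (n * -s) := by
    have : (n : ℝ) ≤ m n := by exact_mod_cast hm n
    gcongr
    nlinarith
  calc _ ≤ 1 * Real.exp (n * -s) := by gcongr; exact hu n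
    _ = _ := one_mul _

theorem abs_midDiff_tsum_le {u : ℕ → ℝ} (hu : ∀ n, |u n| ≤ 1) {k : ℕ} {m : ℕ → ℕ}
    (hm : ∀ n, n + k ≤ m n) {a b c : ℝ} (ha : 3 ≤ a) (hb : 3 ≤ b) (hc : 0 < c)
    (habc : a * b = c ^ 2) :
    |midDiff a b c (fun s => ∑' n, u n * Real.exp (-(((m n : ℝ) + 2) * s)))| ≤
      1 / 3 * (1 / 8) ^ k * (8 / 7) * midDiff a b c (fun s => Real.exp (-s)) := by
  have hm' (n : ℕ) : n ≤ m n := le_trans (Nat.le_add_right n k) (hm n)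
  have hS {s : ℝ} (hs : 0 < s) := summable_mul_exp_neg hu hm' hs
  have h0 : 0 ≤ midDiff a b c (fun s => Real.exp (-s)) := by
    have := (abs_nonneg _).trans (abs_midDiff_exp_neg_mul_le 0 ha hb hc habc)
    linarith
  have heq : midDiff a b c (fun s => ∑' n, u n * Real.exp (-(((m n : ℝ) + 2) * s))) =
      ∑' n, u n * midDiff a b c (fun s => Real.exp (-(((m n : ℝ) + 2) * s))) := by
    have hA := hS (show 0 < a by linarith)
    have hB := hS (show 0 < b by linarith)
    have hC := hS hc
    refine ((((hA.hasSum.add hB.hasSum).sub (hC.hasSum.mul_left 2)).congr_fun fun n => ?_).tsum_eq).symm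
    simp only [midDiff]
    ring
  rw [heq, ← Real.norm_eq_abs]
  have hgeo : HasSum (fun n : ℕ => (1 / 8 : ℝ) ^ n) (8 / 7) := by
    convert hasSum_geometric_of_lt_one (r := (1 / 8 : ℝ)) (by norm_num) (by norm_num) using 1
    norm_num
  have := hgeo.mul_left (1 / 3 * (1 / 8) ^ k * midDiff a b c (fun s => Real.exp (-s)))
  refine (tsum_of_norm_bounded this fun n => ?_).trans (le_of_eq (by ring))
  rw [Real.norm_eq_abs, abs_mul]
  calc |u n| * |midDiff a b c (fun s => Real.exp (-(((m n : ℝ) + 2) * s)))|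
      ≤ 1 * (1 / 3 * (1 / 8) ^ m n * midDiff a b c (fun s => Real.exp (-s))) := by
        gcongr
        · exact hu n
        · exact abs_midDiff_exp_neg_mul_le _ ha hb hc habc
    _ ≤ 1 * (1 / 3 * (1 / 8) ^ (n + k) * midDiff a b c (fun s => Real.exp (-s))) := by
        have : (1 / 8 : ℝ) ^ m n ≤ (1 / 8) ^ (n + k) :=
          pow_le_pow_of_le_one (by norm_num) (by norm_num) (hm n)
        gcongr
    _ = _ := by ring

theorem theta2_eq_evenKernel {y : ℝ} (hy : 0 < y) :
    theta2 y = HurwitzZeta.evenKernel ((1 / 2 : ℝ) : UnitAddCircle) y :=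
  (HurwitzZeta.hasSum_int_evenKernel (1 / 2) hy).tsum_eq

theorem theta3_eq_evenKernel {y : ℝ} (hy : 0 < y) :
    theta3 y = HurwitzZeta.evenKernel ((0 : ℝ) : UnitAddCircle) y := by
  simpa [theta3] using (HurwitzZeta.hasSum_int_evenKernel 0 hy).tsum_eq

theorem theta3_eq_cosKernel {y : ℝ} (hy : 0 < y) :
    theta3 y = HurwitzZeta.cosKernel ((0 : ℝ) : UnitAddCircle) y := by
  have h := HurwitzZeta.hasSum_int_cosKernel 0 hy
  simp only [Complex.ofReal_zero, mul_zero, zero_mul, Complex.exp_zero, one_mul] at h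
  exact (Complex.hasSum_ofReal.mp h).tsum_eq

theorem theta4_eq_cosKernel {y : ℝ} (hy : 0 < y) :
    theta4 y = HurwitzZeta.cosKernel ((1 / 2 : ℝ) : UnitAddCircle) y := by
  have h := HurwitzZeta.hasSum_int_cosKernel (1 / 2) hy
  rw [theta4, ← Complex.ofReal_inj, ← h.tsum_eq, Complex.ofReal_tsum]
  refine tsum_congr fun n => ?_
  have : 2 * (Real.pi : ℂ) * Complex.I * ((1 / 2 : ℝ) : ℂ) * n = n * (Real.pi * Complex.I) := by
    push_cast; ring
  rw [this, Complex.exp_int_mul, Complex.exp_pi_mul_I]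
  push_cast
  rfl

theorem theta3_one_div {y : ℝ} (hy : 0 < y) : theta3 (1 / y) = √y * theta3 y := by
  have := HurwitzZeta.evenKernel_functional_equation ((0 : ℝ) : UnitAddCircle) y
  rw [← theta3_eq_evenKernel hy, ← theta3_eq_cosKernel (one_div_pos.2 hy), ← Real.sqrt_eq_rpow] at this
  have hs := (Real.sqrt_pos.2 hy).ne'
  rw [this]
  field_simp

theorem theta4_one_div {y : ℝ} (hy : 0 < y) : theta4 (1 / y) = √y * theta2 y := by
  have := HurwitzZeta.evenKernel_functional_equation ((1 / 2 : ℝ) : UnitAddCircle) y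
  rw [← theta2_eq_evenKernel hy, ← theta4_eq_cosKernel (one_div_pos.2 hy), ← Real.sqrt_eq_rpow] at this
  have hs := (Real.sqrt_pos.2 hy).ne'
  rw [this]
  field_simp

theorem theta2_one_div {y : ℝ} (hy : 0 < y) : theta2 (1 / y) = √y * theta4 y := by
  have h := theta4_one_div (one_div_pos.2 hy)
  have hs := (Real.sqrt_pos.2 hy).ne'
  rw [one_div_one_div, Real.sqrt_div zero_le_one, Real.sqrt_one] at h
  rw [h]
  field_simp

theorem theta2_pos {y : ℝ} (hy : 0 < y) : 0 < theta2 y :=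
  (HurwitzZeta.hasSum_int_evenKernel (1 / 2) hy).summable.tsum_pos
    (fun _ => (Real.exp_pos _).le) 0 (Real.exp_pos _)

theorem theta4_pos {y : ℝ} (hy : 0 < y) : 0 < theta4 y := by
  have h := theta2_one_div hy
  have h2 := theta2_pos (one_div_pos.2 hy)
  rw [h] at h2
  exact pos_of_mul_pos_right h2 (Real.sqrt_nonneg y)

theorem theta3_div_pi {s : ℝ} (hs : 0 < s) :
    theta3 (s / Real.pi) = 1 + 2 * Real.exp (-s) +
      2 * ∑' n : ℕ, 1 * Real.exp (-(((n ^ 2 + 4 * n + 2 : ℕ) + 2) * s)) := by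
  have hy := div_pos hs Real.pi_pos
  have h := HurwitzZeta.hasSum_nat_cosKernel₀ 0 hy
  rw [← theta3_eq_cosKernel hy] at h
  have h1 := h.summable.tsum_eq_zero_add
  rw [h.tsum_eq, sub_eq_iff_eq_add'] at h1
  have hexp (x : ℝ) : -Real.pi * x * (s / Real.pi) = -(x * s) := by field_simp
  rw [h1, add_assoc, ← tsum_mul_left]
  congr 2
  · rw [hexp]
    simp
  · refine tsum_congr fun n => ?_
    rw [hexp, mul_zero, zero_mul, Real.cos_zero]
    push_cast
    ring_nf

theorem theta4_div_pi {s : ℝ} (hs : 0 < s) :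
    theta4 (s / Real.pi) = 1 - 2 * Real.exp (-s) +
      2 * ∑' n : ℕ, (-1) ^ n * Real.exp (-(((n ^ 2 + 4 * n + 2 : ℕ) + 2) * s)) := by
  have hy := div_pos hs Real.pi_pos
  have h := HurwitzZeta.hasSum_nat_cosKernel₀ (1 / 2) hy
  rw [← theta4_eq_cosKernel hy] at h
  have h1 := h.summable.tsum_eq_zero_add
  rw [h.tsum_eq, sub_eq_iff_eq_add'] at h1
  have hexp (x : ℝ) : -Real.pi * x * (s / Real.pi) = -(x * s) := by field_simp
  have hcos (n : ℕ) : Real.cos (2 * Real.pi * (1 / 2) * (n + 1)) = (-1) ^ (n + 1) := by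
    rw [← Real.cos_nat_mul_pi]; push_cast; ring_nf
  rw [h1, sub_eq_add_neg, add_assoc, ← tsum_mul_left]
  congr 2
  · rw [hcos, hexp]
    simp
  · refine tsum_congr fun n => ?_
    rw [hexp, hcos]
    push_cast
    ring_nf

theorem tsum_int_eq_two_mul_tsum_nat {f : ℤ → ℝ} (hf : Summable f)
    (hsymm : ∀ n : ℕ, f (-(n + 1)) = f n) :
    ∑' n, f n = 2 * (f 0 + ∑' n : ℕ, f (n + 1)) := by
  have hpos : Summable fun n : ℕ => f n := hf.comp_injective Nat.cast_injective
  rw [tsum_of_nat_of_neg_add_one hpos (hpos.congr fun n => (hsymm n).symm), tsum_congr hsymm,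
    ← two_mul, hpos.tsum_eq_zero_add]
  push_cast
  rfl

theorem theta2_eq_tsum_nat {y : ℝ} (hy : 0 < y) :
    theta2 y = 2 * (Real.exp (-Real.pi * (1 / 2) ^ 2 * y) +
      ∑' n : ℕ, Real.exp (-Real.pi * ((n : ℝ) + 1 + 1 / 2) ^ 2 * y)) := by
  rw [theta2, tsum_int_eq_two_mul_tsum_nat (HurwitzZeta.hasSum_int_evenKernel (1 / 2) hy).summable]
  · simp
  · intro n
    congr 1
    push_cast
    ring

theorem theta2_div_pi {s : ℝ} (hs : 0 < s) :
    theta2 (s / Real.pi) = 2 * Real.exp (-(s / 4)) *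
      (1 + ∑' n : ℕ, 1 * Real.exp (-(((n ^ 2 + 3 * n : ℕ) + 2) * s))) := by
  have hexp (x : ℝ) : -Real.pi * x * (s / Real.pi) = -(x * s) := by field_simp
  rw [theta2_eq_tsum_nat (div_pos hs Real.pi_pos), mul_assoc 2, mul_add (Real.exp _), mul_one,
    ← tsum_mul_left]
  congr 2
  · rw [hexp]
    ring_nf
  · refine tsum_congr fun n => ?_
    rw [hexp, one_mul, ← Real.exp_add]
    push_cast
    ring_nf

theorem mul_le_sq_mul_exp {x z p D : ℝ} (hx : 0 < x) (hz : 0 < z) (hp : 1 ≤ p) (hD : 0 ≤ D)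
    (h : x + z - 2 * p ≤ D) : x * z ≤ p ^ 2 * Real.exp D := by
  have h1 : (x + z) / 2 ≤ p * Real.exp (D / 2) := by
    have := Real.add_one_le_exp (D / 2)
    nlinarith
  have h2 : Real.exp D = Real.exp (D / 2) ^ 2 := by
    rw [← Real.exp_nat_mul]; push_cast; ring_nf
  calc x * z ≤ ((x + z) / 2) ^ 2 := by nlinarith [sq_nonneg (x - z)]
    _ ≤ (p * Real.exp (D / 2)) ^ 2 := by gcongr
    _ = _ := by rw [h2]; ring

theorem midDiff_exp_neg_nonneg {a b c : ℝ} (ha : 3 ≤ a) (hb : 3 ≤ b) (hc : 0 < c)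
    (habc : a * b = c ^ 2) : 0 ≤ midDiff a b c (fun s => Real.exp (-s)) := by
  have := (abs_nonneg _).trans (abs_midDiff_exp_neg_mul_le 0 ha hb hc habc)
  linarith

theorem theta4_mul_le {a b c : ℝ} (ha : 3 ≤ a) (hb : 3 ≤ b) (hc : 0 < c) (habc : a * b = c ^ 2) :
    theta4 (a / Real.pi) * theta4 (b / Real.pi) ≤ theta4 (c / Real.pi) ^ 2 := by
  have ha0 : 0 < a := by linarith
  have hb0 : 0 < b := by linarith
  have hA := theta4_pos (div_pos ha0 Real.pi_pos)
  have hB := theta4_pos (div_pos hb0 Real.pi_pos)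
  have hC := theta4_pos (div_pos hc Real.pi_pos)
  have h0 := midDiff_exp_neg_nonneg ha hb hc habc
  have h := (abs_le.1 (abs_midDiff_tsum_le (u := fun n => (-1) ^ n) (by simp) (k := 2)
    (m := fun n => n ^ 2 + 4 * n + 2) (by intro n; nlinarith) ha hb hc habc)).2
  have : theta4 (a / Real.pi) + theta4 (b / Real.pi) ≤ 2 * theta4 (c / Real.pi) := by
    rw [theta4_div_pi ha0, theta4_div_pi hb0, theta4_div_pi hc]
    simp only [midDiff] at h h0
    linarith
  nlinarith [sq_nonneg (theta4 (a / Real.pi) - theta4 (b / Real.pi))]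

theorem theta3_mul_le {a b c : ℝ} (ha : 3 ≤ a) (hb : 3 ≤ b) (hc : 0 < c) (habc : a * b = c ^ 2) :
    theta3 (a / Real.pi) * theta3 (b / Real.pi) ≤ theta3 (c / Real.pi) ^ 2 *
      Real.exp (41 / 20 * midDiff a b c (fun s => Real.exp (-s))) := by
  have hone {s : ℝ} (hs : 0 < s) : 1 ≤ theta3 (s / Real.pi) := by
    rw [theta3_div_pi hs]
    have : 0 ≤ ∑' n : ℕ, 1 * Real.exp (-(((n ^ 2 + 4 * n + 2 : ℕ) + 2) * s)) :=
      tsum_nonneg fun n => by positivity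
    linarith [Real.exp_pos (-s)]
  have ha0 : 0 < a := by linarith
  have hb0 : 0 < b := by linarith
  have h0 := midDiff_exp_neg_nonneg ha hb hc habc
  have h := (abs_le.1 (abs_midDiff_tsum_le (u := fun n => 1) (by simp) (k := 2)
    (m := fun n => n ^ 2 + 4 * n + 2) (by intro n; nlinarith) ha hb hc habc)).2
  refine mul_le_sq_mul_exp (by linarith [hone ha0]) (by linarith [hone hb0]) (hone hc)
    (by positivity) ?_
  rw [theta3_div_pi ha0, theta3_div_pi hb0, theta3_div_pi hc]
  simp only [midDiff] at h h0 ⊢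
  linarith

theorem theta2_mul_le {a b c : ℝ} (ha : 3 ≤ a) (hb : 3 ≤ b) (hc : 0 < c) (habc : a * b = c ^ 2) :
    theta2 (a / Real.pi) * theta2 (b / Real.pi) ≤ theta2 (c / Real.pi) ^ 2 *
      Real.exp (2 / 5 * midDiff a b c (fun s => Real.exp (-s)) -
        1 / 4 * midDiff a b c (fun s => s)) := by
  have hone (s : ℝ) : 1 ≤ 1 + ∑' n : ℕ, 1 * Real.exp (-(((n ^ 2 + 3 * n : ℕ) + 2) * s)) := by
    have : 0 ≤ ∑' n : ℕ, 1 * Real.exp (-(((n ^ 2 + 3 * n : ℕ) + 2) * s)) :=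
      tsum_nonneg fun n => by positivity
    linarith
  have ha0 : 0 < a := by linarith
  have hb0 : 0 < b := by linarith
  have h0 := midDiff_exp_neg_nonneg ha hb hc habc
  have h := (abs_le.1 (abs_midDiff_tsum_le (u := fun n => 1) (by simp) (k := 0)
    (m := fun n => n ^ 2 + 3 * n) (by intro n; nlinarith) ha hb hc habc)).2
  have hU := mul_le_sq_mul_exp (zero_lt_one.trans_le (hone a)) (zero_lt_one.trans_le (hone b))
    (hone c) (D := 2 / 5 * midDiff a b c (fun s => Real.exp (-s))) (by positivity) (by
      simp only [midDiff] at h h0 ⊢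
      linarith)
  rw [theta2_div_pi ha0, theta2_div_pi hb0, theta2_div_pi hc, sub_eq_add_neg, Real.exp_add]
  have he : Real.exp (-(a / 4)) * Real.exp (-(b / 4)) =
      Real.exp (-(c / 4)) ^ 2 * Real.exp (-(1 / 4 * midDiff a b c (fun s => s))) := by
    rw [← Real.exp_nat_mul, ← Real.exp_add, ← Real.exp_add]
    simp only [midDiff]
    push_cast
    ring_nf
  have hmul := mul_le_mul_of_nonneg_left hU
    (show 0 ≤ 4 * (Real.exp (-(a / 4)) * Real.exp (-(b / 4))) by positivity)
  refine (le_of_eq ?_).trans (hmul.trans (le_of_eq ?_))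
  · ring
  · rw [he]
    ring

theorem theta3_pos {y : ℝ} (hy : 0 < y) : 0 < theta3 y := by
  rw [theta3_eq_evenKernel hy]
  exact (HurwitzZeta.hasSum_int_evenKernel 0 hy).tsum_eq ▸
    (HurwitzZeta.hasSum_int_evenKernel 0 hy).summable.tsum_pos
      (fun _ => (Real.exp_pos _).le) 0 (Real.exp_pos _)

/-- The zeta-regularized determinant of the rectangular torus, up to a power and a constant. -/
def torusDet (y : ℝ) : ℝ := y ^ 3 * (theta2 y * theta3 y * theta4 y) ^ 4

theorem torusDet_pos {y : ℝ} (hy : 0 < y) : 0 < torusDet y := by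
  have := theta2_pos hy
  have := theta3_pos hy
  have := theta4_pos hy
  unfold torusDet
  positivity

theorem torusDet_one_div {y : ℝ} (hy : 0 < y) : torusDet (1 / y) = torusDet y := by
  have h : √y ^ 12 = y ^ 6 := by
    rw [show (12 : ℕ) = 2 * 6 by norm_num, pow_mul, Real.sq_sqrt hy.le]
  have hy' := hy.ne'
  calc torusDet (1 / y) = (1 / y) ^ 3 * √y ^ 12 * (theta2 y * theta3 y * theta4 y) ^ 4 := by
        rw [torusDet, theta2_one_div hy, theta3_one_div hy, theta4_one_div hy]
        ring
    _ = torusDet y := by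
        rw [h, torusDet]
        field_simp

theorem theta_mul_lt {a b c : ℝ} (ha : 3 ≤ a) (hb : 3 ≤ b) (hc : 0 < c) (habc : a * b = c ^ 2)
    (hab : a ≠ b) :
    (theta2 (a / Real.pi) * theta3 (a / Real.pi) * theta4 (a / Real.pi)) *
      (theta2 (b / Real.pi) * theta3 (b / Real.pi) * theta4 (b / Real.pi)) <
      (theta2 (c / Real.pi) * theta3 (c / Real.pi) * theta4 (c / Real.pi)) ^ 2 := by
  have hc' := div_pos hc Real.pi_pos
  have ha' : 0 < a / Real.pi := div_pos (by linarith) Real.pi_pos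
  have hb' : 0 < b / Real.pi := div_pos (by linarith) Real.pi_pos
  have hδ : 0 < midDiff a b c (fun s => s) := by
    have h1 : 0 < (a - b) ^ 2 := by
      have := sub_ne_zero.2 hab
      positivity
    have : 2 * c < a + b := by
      refine lt_of_pow_lt_pow_left₀ 2 (by linarith) ?_
      nlinarith
    simp only [midDiff]
    linarith
  have h1 := midDiff_exp_neg_le ha hb hc habc
  have hp2 := theta2_pos hc'
  have hp3 := theta3_pos hc'
  have hp4 := theta4_pos hc'
  have hq3 := mul_pos (theta3_pos ha') (theta3_pos hb')
  have hq4 := mul_pos (theta4_pos ha') (theta4_pos hb')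
  calc _ = (theta2 (a / Real.pi) * theta2 (b / Real.pi)) *
        (theta3 (a / Real.pi) * theta3 (b / Real.pi)) *
        (theta4 (a / Real.pi) * theta4 (b / Real.pi)) := by ring
    _ ≤ (theta2 (c / Real.pi) ^ 2 * Real.exp (2 / 5 * midDiff a b c (fun s => Real.exp (-s)) -
        1 / 4 * midDiff a b c (fun s => s))) * (theta3 (c / Real.pi) ^ 2 *
        Real.exp (41 / 20 * midDiff a b c (fun s => Real.exp (-s)))) *
        theta4 (c / Real.pi) ^ 2 := by
      have h2 := theta2_mul_le ha hb hc habc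
      have h3 := theta3_mul_le ha hb hc habc
      have h4 := theta4_mul_le ha hb hc habc
      exact mul_le_mul (mul_le_mul h2 h3 hq3.le (by positivity)) h4 hq4.le (by positivity)
    _ = (theta2 (c / Real.pi) * theta3 (c / Real.pi) * theta4 (c / Real.pi)) ^ 2 *
        Real.exp (49 / 20 * midDiff a b c (fun s => Real.exp (-s)) -
          1 / 4 * midDiff a b c (fun s => s)) := by
      rw [show 49 / 20 * midDiff a b c (fun s => Real.exp (-s)) -
          1 / 4 * midDiff a b c (fun s => s) =
          (2 / 5 * midDiff a b c (fun s => Real.exp (-s)) - 1 / 4 * midDiff a b c (fun s => s)) +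
          41 / 20 * midDiff a b c (fun s => Real.exp (-s)) by ring, Real.exp_add]
      ring
    _ < (theta2 (c / Real.pi) * theta3 (c / Real.pi) * theta4 (c / Real.pi)) ^ 2 * 1 := by
      gcongr
      rw [Real.exp_lt_one_iff]
      linarith
    _ = _ := mul_one _

theorem torusDet_mul_lt {a b c : ℝ} (ha : 3 / Real.pi ≤ a) (hb : 3 / Real.pi ≤ b) (hc : 0 < c)
    (habc : a * b = c ^ 2) (hab : a ≠ b) : torusDet a * torusDet b < torusDet c ^ 2 := by
  have hπ := Real.pi_pos
  have ha0 : 0 < a := lt_of_lt_of_le (by positivity) ha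
  have hb0 : 0 < b := lt_of_lt_of_le (by positivity) hb
  have h := theta_mul_lt (a := a * Real.pi) (b := b * Real.pi) (c := c * Real.pi)
    (by rwa [← div_le_iff₀ hπ]) (by rwa [← div_le_iff₀ hπ]) (by positivity)
    (by rw [mul_pow, ← habc]; ring) (by simpa [hπ.ne'] using hab)
  simp only [mul_div_cancel_right₀ _ hπ.ne'] at h
  have := theta2_pos ha0
  have := theta3_pos ha0
  have := theta4_pos ha0
  have := theta2_pos hb0
  have := theta3_pos hb0
  have := theta4_pos hb0
  calc torusDet a * torusDet b = (c ^ 2) ^ 3 * ((theta2 a * theta3 a * theta4 a) *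
        (theta2 b * theta3 b * theta4 b)) ^ 4 := by
        rw [← habc, torusDet, torusDet]; ring
    _ < (c ^ 2) ^ 3 * ((theta2 c * theta3 c * theta4 c) ^ 2) ^ 4 := by gcongr
    _ = _ := by rw [torusDet]; ring

theorem torusDet_lt_of_le_pow (k : ℕ) {y : ℝ} (hy : 1 < y) (hk : y ≤ (Real.pi / 3) ^ 2 ^ k) :
    torusDet y < torusDet 1 := by
  have hπ := Real.pi_gt_three
  induction k generalizing y with
  | zero =>
    have hy0 : 0 < y := by linarith
    have h := torusDet_mul_lt (a := y) (b := 1 / y) (c := 1)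
      ((div_le_one Real.pi_pos).2 hπ.le |>.trans hy.le) ?_ one_pos (by field_simp) ?_
    · rw [torusDet_one_div hy0, ← sq] at h
      exact lt_of_pow_lt_pow_left₀ 2 (torusDet_pos one_pos).le h
    · rw [div_le_div_iff₀ Real.pi_pos hy0]
      norm_num at hk
      linarith
    · have : 1 / y < 1 := (div_lt_one hy0).2 hy
      linarith
  | succ k ih =>
    have hy0 : 0 < y := by linarith
    have hz : 1 < √y := Real.lt_sqrt_of_sq_lt (by simpa using hy)
    have hzk : √y ≤ (Real.pi / 3) ^ 2 ^ k := by
      rw [Real.sqrt_le_left (by positivity), ← pow_mul, ← pow_succ]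
      exact hk
    have h1 := ih hz hzk
    have h := torusDet_mul_lt (a := 1) (b := y) (c := √y) ((div_le_one Real.pi_pos).2 hπ.le)
      ((div_le_one Real.pi_pos).2 hπ.le |>.trans hy.le) (by linarith)
      (by rw [Real.sq_sqrt hy0.le, one_mul]) hy.ne
    have h2 : torusDet √y ^ 2 < torusDet 1 ^ 2 :=
      pow_lt_pow_left₀ h1 (torusDet_pos (by linarith)).le two_ne_zero
    have hp := torusDet_pos one_pos
    nlinarith

theorem torusDet_lt_of_one_lt {y : ℝ} (hy : 1 < y) : torusDet y < torusDet 1 := by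
  have hπ : 1 < Real.pi / 3 := by linarith [Real.pi_gt_three]
  obtain ⟨k, hk⟩ := pow_unbounded_of_one_lt y hπ
  exact torusDet_lt_of_le_pow k hy (hk.le.trans (pow_le_pow_right₀ hπ.le k.lt_two_pow_self.le))

theorem torusDet_lt {y : ℝ} (hy : 0 < y) (h1 : y ≠ 1) : torusDet y < torusDet 1 := by
  rcases lt_or_gt_of_ne h1 with h | h
  · rw [← torusDet_one_div hy]
    exact torusDet_lt_of_one_lt ((one_lt_div hy).2 h)
  · exact torusDet_lt_of_one_lt h

/-- `y³ (θ₂(iy)θ₃(iy)θ₄(iy))⁴ ≤ (θ₂(i)θ₃(i)θ₄(i))⁴` for all `y > 0`,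
with equality iff `y = 1`: the zeta-regularized determinant of the Laplace–Beltrami
operator on rectangular tori of unit area is maximal exactly for the square torus. -/
theorem determinant_max_square_torus (y : ℝ) (hy : 0 < y) :
    y ^ 3 * (theta2 y * theta3 y * theta4 y) ^ 4 ≤
      (theta2 1 * theta3 1 * theta4 1) ^ 4 ∧
    (y ^ 3 * (theta2 y * theta3 y * theta4 y) ^ 4 =
      (theta2 1 * theta3 1 * theta4 1) ^ 4 ↔ y = 1) := by
  have h1 : (theta2 1 * theta3 1 * theta4 1) ^ 4 = torusDet 1 := by simp [torusDet]
  rw [h1]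
  change torusDet y ≤ torusDet 1 ∧ (torusDet y = torusDet 1 ↔ y = 1)
  refine ⟨?_, fun h => ?_, fun h => by rw [h]⟩
  · rcases eq_or_ne y 1 with rfl | h
    · exact le_rfl
    · exact (torusDet_lt hy h).le
  · by_contra hne
    exact (torusDet_lt hy hne).ne h

end
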